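/- For every vertex x ≠ 0 of the tree, the second moment of the hitting time of the parent p(x) starting from x satisfies E[(T^x_{p(x)})²] = (2/(μ_x·π(x)))·Σ_{b∈B_x} π(B_b)²/(μ_b·π(b)) − E[T^x_{p(x)}]. -/

import Mathlib

open MeasureTheory ProbabilityTheory Filter Topology ENNReal

noncomputable section

/-- A discrete-time birth-and-death chain on a countable rooted tree `I`.
The tree is encoded by a root, a parent map and a depth function; the chain is
encoded by its transition matrix `P` (nonzero only between tree-neighbours and
on the diagonal) and by the laws `law x` of the trajectories started at `x`,
characterised by the cylinder formula.  `invm` is the reversible invariant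
probability measure of the chain (positive recurrence). -/
structure TreeChain (I : Type*) [MeasurableSpace I] where
  root : I
  par : I → I
  depth : I → ℕ
  par_root : par root = root
  depth_root : depth root = 0
  depth_eq_zero : ∀ x, depth x = 0 → x = root
  depth_par : ∀ x, x ≠ root → depth x = depth (par x) + 1
  P : I → I → ℝ≥0∞
  P_row : ∀ x, ∑' y, P x y = 1
  P_support : ∀ x y, P x y ≠ 0 → y = x ∨ y = par x ∨ x = par y
  lam_pos : ∀ x, x ≠ root → P (par x) x ≠ 0
  mu_pos : ∀ x, x ≠ root → P x (par x) ≠ 0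
  law : I → Measure (ℕ → I)
  law_prob : ∀ x, IsProbabilityMeasure (law x)
  law_start : ∀ x, law x {ω | ω 0 = x} = 1
  law_cyl : ∀ x (n : ℕ) (γ : ℕ → I), γ 0 = x →
    law x {ω | ∀ i ≤ n, ω i = γ i} = ∏ i ∈ Finset.range n, P (γ i) (γ (i + 1))
  invm : I → ℝ≥0∞
  invm_pos : ∀ x, invm x ≠ 0
  invm_sum : ∑' x, invm x = 1
  invm_rev : ∀ x y, invm x * P x y = invm y * P y x

/-- The hitting time of `y`, as an extended nonnegative real (`∞` if `y` is never hit). -/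
def hitTime {I : Type*} (y : I) (ω : ℕ → I) : ℝ≥0∞ :=
  ⨅ (t : ℕ) (_ : ω t = y), (t : ℝ≥0∞)

namespace TreeChain

variable {I : Type*} [MeasurableSpace I] (c : TreeChain I)

/-- The branch `B_x` stemming from `x`: the set of descendants of `x` (including `x`). -/
def branch (x : I) : Set I := {y | ∃ n, c.par^[n] y = x}

/-- The set `ℓ(x)` of vertices on the path from `x` to the root, the root excluded. -/
def pathToRoot (x : I) : Set I := {y | ∃ i < c.depth x, c.par^[i] x = y}

/-- The set `σ(x)` of children of `x`. -/
def children (x : I) : Set I := {y | y ≠ c.root ∧ c.par y = x}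

/-- `μ_x`, the transition probability from `x` to its parent. -/
def mu (x : I) : ℝ≥0∞ := c.P x (c.par x)

/-- `λ_x`, the transition probability from the parent of `x` to `x`. -/
def lamP (x : I) : ℝ≥0∞ := c.P (c.par x) x

/-- `π(A)`, the invariant mass of a set of vertices. -/
def piSet (A : Set I) : ℝ≥0∞ := ∑' y : A, c.invm (y : I)

/-- `E[T^x_y]`, the expected hitting time of `y` for the chain started at `x`. -/
def ET (x y : I) : ℝ≥0∞ := ∫⁻ ω, hitTime y ω ∂(c.law x)

/-- `E[(T^x_y)²]`, the second moment of the hitting time of `y` started at `x`. -/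
def ET2 (x y : I) : ℝ≥0∞ := ∫⁻ ω, (hitTime y ω) ^ 2 ∂(c.law x)

/-- The normalised hitting time `T^x_y / E[T^x_y]` as a real random variable. -/
def ratio (x y : I) (ω : ℕ → I) : ℝ := (hitTime y ω).toReal / (c.ET x y).toReal

/-- `α(a)`: the child of the root lying on the path from `a` to the root. -/
def alphaVert (a : I) : I := c.par^[c.depth a - 1] a

/-- The drift constant `K_a = sup_{b ∈ B_{α(a)}} μ_b · E[T^b_{p(b)}]`. -/
def Kdrift (a : I) : ℝ≥0∞ :=
  ⨆ b ∈ c.branch (c.alphaVert a), c.mu b * c.ET b (c.par b)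

/-- The global constant `K'_a = sup_{b ∈ I} μ_b · E[T^b_{p(b)}]`. -/
def Kdrift' : ℝ≥0∞ := ⨆ b : I, c.mu b * c.ET b (c.par b)

/-- The quantity `Q_x = π(B_x)⁻¹ · Σ_{b ∈ B_x} π(B_b)²/(μ_b π(b))`. -/
def Qx (x : I) : ℝ≥0∞ :=
  (c.piSet (c.branch x))⁻¹ *
    ∑' b : c.branch x, (c.piSet (c.branch (b : I))) ^ 2 / (c.mu (b : I) * c.invm (b : I))

/-- `Q_a = sup_{x ∈ ℓ(a)} Q_x`. -/
def Qsup (a : I) : ℝ≥0∞ := ⨆ x ∈ c.pathToRoot a, c.Qx x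

/-- `R_a = Σ_{b ∈ ℓ(a)} π(B_b)²/(μ_b π(b))`. -/
def Rsum (a : I) : ℝ≥0∞ :=
  ∑' b : c.pathToRoot a, (c.piSet (c.branch (b : I))) ^ 2 / (c.mu (b : I) * c.invm (b : I))

/-- The set `C_{a,k}`: union over the vertices `a_l`, `k < l ≤ d(a)`, of the path from
`a_k` to the root, of the branches stemming from the children of `a_l` other
than `a_{l-1}`. -/
def Cset (a : I) (k : ℕ) : Set I :=
  {y | ∃ l, k + 1 ≤ l ∧ l ≤ c.depth a ∧
    ∃ ch, ch ∈ c.children (c.par^[l] a) ∧ ch ≠ c.par^[l - 1] a ∧ y ∈ c.branch ch}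

end TreeChain

/-- The strong drift condition `0^ℓ-SD` toward the root, for a family of chains
`c n` with distinguished vertices `a n` (the limit `a → ∞` being `n → ∞`). -/
def StrongDrift {I : ℕ → Type*} [∀ n, MeasurableSpace (I n)]
    (c : ∀ n, TreeChain (I n)) (a : ∀ n, I n) : Prop :=
  (∃ Kmu : ℝ≥0∞, 0 < Kmu ∧
      ∀ n, ∀ b ∈ (c n).branch ((c n).alphaVert (a n)), Kmu ≤ (c n).mu b) ∧
  Tendsto (fun n => ((c n).Kdrift (a n)) ^ 2 / (c n).ET (a n) (c n).root) atTop (𝓝 0)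


/-- A measurable set of a product space does not separate two families whose coordinates are
pairwise inseparable by measurable sets. -/
theorem mem_iff_of_forall_measurableSet_pi {ι α : Type*} [MeasurableSpace α]
    {B : Set (ι → α)} (hB : MeasurableSet B) {f g : ι → α}
    (h : ∀ i, ∀ s : Set α, MeasurableSet s → (f i ∈ s ↔ g i ∈ s)) : f ∈ B ↔ g ∈ B := by
  let m : MeasurableSpace (ι → α) :=
    { MeasurableSet' := fun B => f ∈ B ↔ g ∈ B
      measurableSet_empty := by simp
      measurableSet_compl := fun s hs => by simp only [Set.mem_compl_iff, hs]
      measurableSet_iUnion := fun s hs => by simp only [Set.mem_iUnion, hs] }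
  have hle : MeasurableSpace.pi ≤ m := by
    refine iSup_le fun i => ?_
    rintro _ ⟨s, hs, rfl⟩
    exact h i s hs
  exact hle B hB

theorem hitTime_eq_top {I : Type*} {y : I} {ω : ℕ → I} (h : ∀ t, ω t ≠ y) :
    hitTime y ω = ⊤ := by
  simp [hitTime, h]

theorem hitTime_eq_natCast {I : Type*} {y : I} {ω : ℕ → I} {N : ℕ} (hN : ω N = y)
    (h : ∀ t < N, ω t ≠ y) : hitTime y ω = N := by
  refine le_antisymm (iInf₂_le N hN) (le_iInf₂ fun t ht => ?_)
  exact_mod_cast not_lt.1 fun hlt => h t hlt ht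

open Classical in
/-- `T² + T = ∑ₙ 2 (n + 1) 1_{T > n}`. -/
theorem tsum_ite_hitTime {I : Type*} (y : I) (ω : ℕ → I) :
    (∑' n : ℕ, if ∀ i ≤ n, ω i ≠ y then (2 * (n + 1) : ℝ≥0∞) else 0)
      = hitTime y ω ^ 2 + hitTime y ω := by
  by_cases h : ∃ t, ω t = y
  · have hlt : ∀ t < Nat.find h, ω t ≠ y := fun t ht => Nat.find_min h ht
    rw [hitTime_eq_natCast (Nat.find_spec h) hlt]
    generalize hN : Nat.find h = N
    have hiff : ∀ n : ℕ, (∀ i ≤ n, ω i ≠ y) ↔ n < N := by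
      intro n
      rw [← hN, Nat.lt_find_iff]
    simp only [hiff]
    rw [tsum_eq_sum (s := Finset.range N) (fun n hn => by simpa using hn)]
    rw [Finset.sum_congr rfl (g := fun n : ℕ => (2 * (n + 1) : ℝ≥0∞))
      (fun n hn => if_pos (Finset.mem_range.1 hn))]
    clear hiff hN
    induction N with
    | zero => simp
    | succ k ih => rw [Finset.sum_range_succ, ih]; push_cast; ring
  · push Not at h
    rw [hitTime_eq_top h]
    simp only [h, ne_eq, not_false_eq_true, implies_true, if_true, add_top]
    refine top_unique ?_
    calc (⊤ : ℝ≥0∞) = ∑' _ : ℕ, (1 : ℝ≥0∞) :=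
          (ENNReal.tsum_const_eq_top_of_ne_zero one_ne_zero).symm
      _ ≤ _ := ENNReal.tsum_le_tsum fun n => by
        have : (1 : ℝ≥0∞) ≤ ((2 * (n + 1) : ℕ) : ℝ≥0∞) := by exact_mod_cast (by omega)
        simpa using this

/-- Summing a sequence of extended nonnegative reals along a sum of two indices. -/
theorem ENNReal.tsum_tsum_add (a : ℕ → ℝ≥0∞) :
    ∑' m, ∑' k, a (m + k) = ∑' n : ℕ, (n + 1) * a n := by
  rw [← ENNReal.tsum_prod, ← Finset.HasAntidiagonal.sigmaAntidiagonalEquivProd.tsum_eq,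
    ENNReal.tsum_sigma']
  refine tsum_congr fun n => ?_
  rw [tsum_congr (g := fun _ => a n)
    (fun p => by simpa using congrArg a (Finset.HasAntidiagonal.mem_antidiagonal.1 p.2))]
  simp

theorem measurableSet_cylinder {I : Type*} [MeasurableSpace I] [Countable I]
    [MeasurableSingletonClass I] (S : Set I) (γ : ℕ → I) (m n : ℕ) :
    MeasurableSet {ω : ℕ → I | (∀ i ≤ m, ω i = γ i) ∧ ∀ i, m ≤ i → i ≤ m + n → ω i ∈ S} := by
  have hS : MeasurableSet S := S.to_countable.measurableSet
  measurability

theorem measurableSet_forall_ne {I : Type*} [MeasurableSpace I]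
    [MeasurableSingletonClass I] (y : I) (n : ℕ) :
    MeasurableSet {ω : ℕ → I | ∀ i ≤ n, ω i ≠ y} := by
  measurability

theorem measurable_hitTime {I : Type*} [MeasurableSpace I] [MeasurableSingletonClass I]
    (y : I) : Measurable (hitTime y : (ℕ → I) → ℝ≥0∞) := by
  classical
  have h : (hitTime y : (ℕ → I) → ℝ≥0∞) =
      fun ω => ⨅ t : ℕ, if ω t = y then (t : ℝ≥0∞) else ⊤ := by
    ext ω
    exact iInf_congr fun t => by by_cases h : ω t = y <;> simp [h]
  rw [h]
  refine Measurable.iInf fun t => Measurable.ite ?_ measurable_const measurable_const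
  measurability

namespace TreeChain

variable {I : Type*} [MeasurableSpace I] (c : TreeChain I)

theorem exists_P_ne_zero (y : I) : ∃ z, c.P z y ≠ 0 := by
  by_contra! h
  have h0 : ∀ w, c.P y w = 0 := fun w => by
    have := c.invm_rev y w
    rw [h w, mul_zero] at this
    exact (mul_eq_zero.1 this).resolve_left (c.invm_pos y)
  have := c.P_row y
  simp [h0] at this

theorem measurableSet_singleton_of_P_ne_zero [Countable I] {z y : I} (h : c.P z y ≠ 0) :
    MeasurableSet ({y} : Set I) := by
  classical
  suffices measurableAtom y = {y} from this ▸ MeasurableSet.measurableAtom_of_countable y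
  refine Set.Subset.antisymm (fun y' hy' => ?_)
    (Set.singleton_subset_iff.2 (mem_measurableAtom_self y))
  by_contra hne
  rw [Set.mem_singleton_iff] at hne
  have hsep : ∀ s : Set I, MeasurableSet s → (y' ∈ s ↔ y ∈ s) := fun s hs =>
    ⟨fun h1 => by_contra fun h2 => mem_of_mem_measurableAtom hy' hs.compl h2 h1,
      fun h1 => mem_of_mem_measurableAtom hy' hs h1⟩
  let A : I → Set (ℕ → I) := fun w => {ω | ∀ i ≤ 1, ω i = if i = 0 then z else w}
  have hA : ∀ w, c.law z (A w) = c.P z w := fun w => by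
    simpa using c.law_cyl z 1 (fun i => if i = 0 then z else w) (by simp)
  have hmem : ∀ w ω, ω ∈ A w ↔ ω 0 = z ∧ ω 1 = w := fun w ω => by
    refine ⟨fun hω => ⟨by simpa using hω 0 (by simp), by simpa using hω 1 le_rfl⟩, ?_⟩
    rintro ⟨h0, h1⟩ i hi
    interval_cases i <;> simp [h0, h1]
  have hcover : {ω : ℕ → I | ω 0 = z} ⊆ ⋃ w : {w // w ≠ y}, toMeasurable (c.law z) (A w) := by
    intro ω hω
    rw [Set.mem_iUnion]
    by_cases h1 : ω 1 = y
    · refine ⟨⟨y', hne⟩, ?_⟩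
      have hup : Function.update ω 1 y' ∈ toMeasurable (c.law z) (A y') :=
        subset_toMeasurable _ _ ((hmem _ _).2 ⟨by simpa using hω, by simp⟩)
      refine (mem_iff_of_forall_measurableSet_pi (measurableSet_toMeasurable _ _)
        fun i s hs => ?_).1 hup
      by_cases hi : i = 1
      · subst hi
        simpa [h1] using hsep s hs
      · simp [hi]
    · exact ⟨⟨ω 1, h1⟩, subset_toMeasurable _ _ ((hmem _ _).2 ⟨hω, rfl⟩)⟩
  have hle : (1 : ℝ≥0∞) ≤ ∑' w : {w // w ≠ y}, c.P z w := by
    rw [← c.law_start z]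
    refine (measure_mono hcover).trans ((measure_iUnion_le _).trans ?_)
    simp only [measure_toMeasurable, hA, le_refl]
  have hsum : c.P z y + ∑' w : {w // w ≠ y}, c.P z w = 1 := by
    rw [← c.P_row z, ← ENNReal.summable.tsum_add_tsum_compl (s := {y}) ENNReal.summable,
      tsum_singleton]
    rfl
  have hlt : ∑' w : {w // w ≠ y}, c.P z w < c.P z y + ∑' w : {w // w ≠ y}, c.P z w := by
    rw [add_comm]
    refine ENNReal.lt_add_right (fun htop => ?_) h
    simp [htop] at hsum
  exact absurd (hle.trans_lt hlt) (by simp [hsum])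

theorem measurableSingletonClass {I : Type*} [MeasurableSpace I] [Countable I]
    (c : TreeChain I) : MeasurableSingletonClass I :=
  ⟨fun y => (c.exists_P_ne_zero y).elim fun _ h => c.measurableSet_singleton_of_P_ne_zero h⟩

/-! ### Combinatorics of the tree -/

theorem depth_iterate (y : I) (n : ℕ) : c.depth (c.par^[n] y) = c.depth y - n := by
  induction n with
  | zero => rfl
  | succ n ih =>
    rw [Function.iterate_succ_apply']
    by_cases h : c.par^[n] y = c.root
    · rw [h, c.depth_root] at ih
      rw [h, c.par_root, c.depth_root]
      omega
    · have := c.depth_par _ h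
      omega

theorem depth_ne_zero {x : I} (hx : x ≠ c.root) : c.depth x ≠ 0 :=
  fun h => hx (c.depth_eq_zero x h)

theorem mem_branch_self (x : I) : x ∈ c.branch x := ⟨0, rfl⟩

theorem mem_branch_iff_par {x y : I} : y ∈ c.branch x ↔ y = x ∨ c.par y ∈ c.branch x := by
  constructor
  · rintro ⟨n | n, h⟩
    · exact Or.inl h
    · exact Or.inr ⟨n, h⟩
  · rintro (rfl | ⟨n, h⟩)
    · exact c.mem_branch_self y
    · exact ⟨n + 1, h⟩

theorem branch_trans {x b y : I} (hb : b ∈ c.branch x) (hy : y ∈ c.branch b) :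
    y ∈ c.branch x := by
  obtain ⟨n, rfl⟩ := hb
  obtain ⟨m, rfl⟩ := hy
  exact ⟨n + m, Function.iterate_add_apply _ _ _ _⟩

theorem depth_le_of_mem_branch {x y : I} (h : y ∈ c.branch x) : c.depth x ≤ c.depth y := by
  obtain ⟨n, rfl⟩ := h
  rw [depth_iterate]
  exact Nat.sub_le _ _

theorem ne_root_of_mem_branch {x y : I} (hx : x ≠ c.root) (h : y ∈ c.branch x) :
    y ≠ c.root := by
  rintro rfl
  have := c.depth_le_of_mem_branch h
  rw [c.depth_root] at this
  exact c.depth_ne_zero hx (by omega)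

theorem par_notMem_branch {x : I} (hx : x ≠ c.root) : c.par x ∉ c.branch x := fun h => by
  have := c.depth_le_of_mem_branch h
  have := c.depth_par x hx
  omega

theorem par_ne_self {x : I} (hx : x ≠ c.root) : c.par x ≠ x := fun h =>
  c.par_notMem_branch hx (h.symm ▸ c.mem_branch_self x)

theorem mem_branch_or_eq_par {x y w : I} (hy : y ∈ c.branch x) (h : c.P y w ≠ 0) :
    w ∈ c.branch x ∨ w = c.par x := by
  rcases c.P_support y w h with rfl | rfl | rfl
  · exact Or.inl hy
  · rcases c.mem_branch_iff_par.1 hy with rfl | h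
    · exact Or.inr rfl
    · exact Or.inl h
  · exact Or.inl (c.mem_branch_iff_par.2 (Or.inr hy))

theorem P_par_eq_zero {x y : I} (hx : x ≠ c.root) (hy : y ∈ c.branch x) (hne : y ≠ x) :
    c.P y (c.par x) = 0 := by
  by_contra h
  have hyr := c.ne_root_of_mem_branch hx hy
  have hd := c.depth_le_of_mem_branch hy
  have hdx := c.depth_par x hx
  have hdy := c.depth_par y hyr
  rcases c.P_support _ _ h with h | h | h
  · rw [h] at hdx; omega
  · rcases c.mem_branch_iff_par.1 hy with rfl | h'
    · exact hne rfl
    · exact c.par_notMem_branch hx (h ▸ h')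
  · by_cases hr : c.par x = c.root
    · rw [hr, c.par_root] at h
      exact hyr h
    · have := c.depth_par _ hr
      rw [← h] at this
      omega

open Classical in
/-- A branch is the disjoint union of its stem and of the branches of the children. -/
theorem ite_mem_branch {z : I} (hz : z ≠ c.root) (y : I) :
    (if y ∈ c.branch z then (1 : ℝ≥0∞) else 0)
      = (if y = z then 1 else 0) + ∑' w, if c.par w = z ∧ y ∈ c.branch w then 1 else 0 := by
  have hroot : ∀ {w}, c.par w = z → w ≠ c.root := by
    rintro w rfl rfl
    exact hz c.par_root
  by_cases hyz : y = z
  · subst hyz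
    have h0 : ∀ w, ¬ (c.par w = y ∧ y ∈ c.branch w) := by
      rintro w ⟨rfl, h⟩
      exact c.par_notMem_branch (hroot rfl) h
    simp [h0, c.mem_branch_self]
  · by_cases hy : y ∈ c.branch z
    · obtain ⟨n | n, h⟩ := id hy
      · exact absurd h hyz
      · rw [Function.iterate_succ_apply'] at h
        have hn : y ∈ c.branch (c.par^[n] y) := ⟨n, rfl⟩
        rw [tsum_eq_single (c.par^[n] y)]
        · simp [h, hn, hy, hyz]
        rintro w hw
        refine if_neg ?_
        rintro ⟨h1, m, rfl⟩
        have d1 := c.depth_par _ (hroot h)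
        have d2 := c.depth_par _ (hroot h1)
        rw [h, depth_iterate] at d1
        rw [h1, depth_iterate] at d2
        have : m = n := by omega
        exact hw (this ▸ rfl)
    · have h0 : ∀ w, ¬ (c.par w = z ∧ y ∈ c.branch w) := by
        rintro w ⟨rfl, h⟩
        exact hy (c.branch_trans (c.mem_branch_iff_par.2 (Or.inr (c.mem_branch_self _))) h)
      simp [h0, hy, hyz]

open Classical in
theorem piSet_eq_tsum (A : Set I) : c.piSet A = ∑' y, if y ∈ A then c.invm y else 0 := by
  rw [piSet, tsum_subtype]
  rfl

open Classical in
theorem piSet_branch {z : I} (hz : z ≠ c.root) :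
    c.piSet (c.branch z) = c.invm z + ∑' w, if c.par w = z then c.piSet (c.branch w) else 0 := by
  have h : ∀ y, (if y ∈ c.branch z then c.invm y else 0) = (if y = z then c.invm z else 0)
      + ∑' w, if c.par w = z ∧ y ∈ c.branch w then c.invm y else 0 := fun y => by
    have := congrArg (c.invm y * ·) (c.ite_mem_branch hz y)
    simp only [mul_add, ← ENNReal.tsum_mul_left, mul_ite, mul_one, mul_zero] at this
    rw [this]
    congr 1
    split_ifs with h
    · rw [h]
    · rfl
  rw [piSet_eq_tsum, tsum_congr h, ENNReal.tsum_add, tsum_ite_eq, ENNReal.tsum_comm]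
  congr 1
  refine tsum_congr fun w => ?_
  split_ifs with hw
  · simp [hw, piSet_eq_tsum]
  · simp [hw]

theorem piSet_ne_top (A : Set I) : c.piSet A ≠ ⊤ := by
  refine ne_top_of_le_ne_top one_ne_top ?_
  rw [← c.invm_sum]
  exact ENNReal.tsum_comp_le_tsum_of_injective Subtype.val_injective _

theorem invm_ne_top (x : I) : c.invm x ≠ ⊤ :=
  ne_top_of_le_ne_top one_ne_top (c.invm_sum ▸ ENNReal.le_tsum x)

theorem P_ne_top (x y : I) : c.P x y ≠ ⊤ :=
  ne_top_of_le_ne_top one_ne_top (c.P_row x ▸ ENNReal.le_tsum y)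

theorem conductance_ne_zero {x : I} (hx : x ≠ c.root) : c.mu x * c.invm x ≠ 0 :=
  mul_ne_zero (c.mu_pos x hx) (c.invm_pos x)

theorem conductance_ne_top (x : I) : c.mu x * c.invm x ≠ ⊤ :=
  ENNReal.mul_ne_top (c.P_ne_top _ _) (c.invm_ne_top x)

/-! ### The chain killed outside a set -/

/-- The transition operator of the chain killed when leaving `S`. -/
def killedOp (S : Set I) (f : I → ℝ≥0∞) : I → ℝ≥0∞ :=
  S.indicator fun y => ∑' w, c.P y w * S.indicator f w

/-- The probability of staying in `S` up to time `n`. -/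
def survival (S : Set I) (n : ℕ) : I → ℝ≥0∞ := (c.killedOp S)^[n] (S.indicator 1)

theorem survival_succ (S : Set I) (n : ℕ) :
    c.survival S (n + 1) = c.killedOp S (c.survival S n) :=
  Function.iterate_succ_apply' _ _ _

theorem survival_of_notMem {S : Set I} {y : I} (hy : y ∉ S) (n : ℕ) : c.survival S n y = 0 := by
  cases n with
  | zero => exact Set.indicator_of_notMem hy _
  | succ n => rw [survival_succ]; exact Set.indicator_of_notMem hy _

theorem killedOp_add (S : Set I) (f g : I → ℝ≥0∞) :
    c.killedOp S (f + g) = c.killedOp S f + c.killedOp S g := by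
  ext y
  by_cases hy : y ∈ S
  · simp only [killedOp, hy, Set.indicator_of_mem, Pi.add_apply, ← ENNReal.tsum_add]
    refine tsum_congr fun w => ?_
    by_cases hw : w ∈ S <;> simp [hw, mul_add]
  · simp [killedOp, hy]

theorem killedOp_smul (S : Set I) (a : ℝ≥0∞) (f : I → ℝ≥0∞) :
    c.killedOp S (a • f) = a • c.killedOp S f := by
  ext y
  by_cases hy : y ∈ S
  · simp only [killedOp, hy, Set.indicator_of_mem, Pi.smul_apply, smul_eq_mul,
      ← ENNReal.tsum_mul_left]
    refine tsum_congr fun w => ?_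
    by_cases hw : w ∈ S
    · simp only [hw, Set.indicator_of_mem, Pi.smul_apply, smul_eq_mul]
      ring
    · simp [hw]
  · simp [killedOp, hy]

/-- The killed transition operator is symmetric with respect to the invariant measure. -/
theorem tsum_mul_killedOp (S : Set I) (f g : I → ℝ≥0∞) :
    ∑' y, c.invm y * (f y * c.killedOp S g y) = ∑' y, c.invm y * (c.killedOp S f y * g y) := by
  classical
  have h1 : ∀ f g : I → ℝ≥0∞, ∀ y, c.invm y * (f y * c.killedOp S g y)
      = ∑' w, c.invm y * c.P y w * (if y ∈ S ∧ w ∈ S then f y * g w else 0) := by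
    intro f g y
    by_cases hy : y ∈ S
    · simp only [killedOp, hy, Set.indicator_of_mem, ← ENNReal.tsum_mul_left, true_and]
      refine tsum_congr fun w => ?_
      by_cases hw : w ∈ S
      · simp only [hw, Set.indicator_of_mem, if_true]
        ring
      · simp [hw]
    · simp [killedOp, hy]
  simp only [mul_comm (c.killedOp S f _), h1]
  rw [ENNReal.tsum_comm]
  refine tsum_congr fun y => tsum_congr fun w => ?_
  rw [c.invm_rev w y, mul_comm (f w)]
  simp only [and_comm]

theorem tsum_mul_killedOp_iterate (S : Set I) (n : ℕ) (f g : I → ℝ≥0∞) :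
    ∑' y, c.invm y * (f y * (c.killedOp S)^[n] g y)
      = ∑' y, c.invm y * ((c.killedOp S)^[n] f y * g y) := by
  induction n generalizing f with
  | zero => rfl
  | succ n ih => rw [Function.iterate_succ_apply', tsum_mul_killedOp, ih,
      Function.iterate_succ_apply]

/-! ### Trajectories staying in a set -/

section Law

variable [Countable I]

theorem law_cylinder_survival (S : Set I) (n m : ℕ) (γ : ℕ → I) :
    c.law (γ 0) {ω | (∀ i ≤ m, ω i = γ i) ∧ ∀ i, m ≤ i → i ≤ m + n → ω i ∈ S}
      = c.law (γ 0) {ω | ∀ i ≤ m, ω i = γ i} * c.survival S n (γ m) := by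
  classical
  have := c.measurableSingletonClass
  induction n generalizing m γ with
  | zero =>
    by_cases h : γ m ∈ S
    · simp only [survival, Function.iterate_zero, id, h, Set.indicator_of_mem, Pi.one_apply,
        mul_one]
      congr 1
      ext ω
      refine ⟨fun hω => hω.1, fun hω => ⟨hω, fun i h1 h2 => ?_⟩⟩
      obtain rfl : i = m := by omega
      rwa [hω i le_rfl]
    · rw [c.survival_of_notMem h, mul_zero]
      convert measure_empty (μ := c.law (γ 0))
      refine Set.eq_empty_of_forall_notMem fun ω hω => h ?_
      rw [← hω.1 m le_rfl]
      exact hω.2 m le_rfl (by omega)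
  | succ n ih =>
    by_cases h : γ m ∈ S
    swap
    · rw [c.survival_of_notMem h, mul_zero]
      convert measure_empty (μ := c.law (γ 0))
      refine Set.eq_empty_of_forall_notMem fun ω hω => h ?_
      rw [← hω.1 m le_rfl]
      exact hω.2 m le_rfl (by omega)
    let γ' : I → ℕ → I := fun w => Function.update γ (m + 1) w
    have hγ' : ∀ w, ∀ i ≤ m, γ' w i = γ i := fun w i hi =>
      Function.update_of_ne (by omega) _ _
    have hγm : ∀ w, γ' w (m + 1) = w := fun w => Function.update_self _ _ _
    have hset : {ω : ℕ → I | (∀ i ≤ m, ω i = γ i) ∧ ∀ i, m ≤ i → i ≤ m + (n + 1) → ω i ∈ S}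
        = ⋃ w, {ω | (∀ i ≤ m + 1, ω i = γ' w i) ∧
            ∀ i, m + 1 ≤ i → i ≤ m + 1 + n → ω i ∈ S} := by
      ext ω
      simp only [Set.mem_ofPred_eq, Set.mem_iUnion]
      constructor
      · rintro ⟨h1, h2⟩
        refine ⟨ω (m + 1), fun i hi => ?_, fun i hi hi' => h2 i (by omega) (by omega)⟩
        rcases Nat.lt_or_ge i (m + 1) with hlt | hge
        · rw [hγ' _ i (by omega), h1 i (by omega)]
        · obtain rfl : i = m + 1 := by omega
          rw [hγm]
      · rintro ⟨w, h1, h2⟩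
        have h1' : ∀ i ≤ m, ω i = γ i := fun i hi => (h1 i (by omega)).trans (hγ' w i hi)
        refine ⟨h1', fun i hi hi' => ?_⟩
        rcases hi.eq_or_lt with rfl | hlt
        · rwa [h1' m le_rfl]
        · exact h2 i (by omega) (by omega)
    rw [hset, measure_iUnion ?_ fun w => measurableSet_cylinder S _ _ _, survival_succ,
      killedOp, Set.indicator_of_mem h, ← ENNReal.tsum_mul_left]
    · refine tsum_congr fun w => ?_
      have h0 : γ' w 0 = γ 0 := hγ' w 0 (Nat.zero_le _)
      have key := ih (m + 1) (γ' w)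
      rw [h0, hγm] at key
      rw [key, c.law_cyl _ (m + 1) (γ' w) h0, c.law_cyl _ m γ rfl, Finset.prod_range_succ, hγm,
        hγ' w m le_rfl, mul_assoc]
      congr 1
      · refine Finset.prod_congr rfl fun i hi => ?_
        rw [Finset.mem_range] at hi
        rw [hγ' w i hi.le, hγ' w (i + 1) hi]
      · congr 1
        by_cases hw : w ∈ S
        · rw [Set.indicator_of_mem hw]
        · rw [Set.indicator_of_notMem hw, c.survival_of_notMem hw]
    · intro w w' hne
      refine Set.disjoint_left.2 fun ω h1 h2 => hne ?_
      rw [← hγm w, ← hγm w', ← h1.1 _ le_rfl, ← h2.1 _ le_rfl]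

theorem law_forall_ne (x y : I) (n : ℕ) :
    c.law x {ω | ∀ i ≤ n, ω i ≠ y} = c.survival {y}ᶜ n x := by
  have := c.measurableSingletonClass
  have := c.law_prob x
  have h := c.law_cylinder_survival {y}ᶜ n 0 (fun _ => x)
  have h0 : {ω : ℕ → I | ∀ i ≤ 0, ω i = x} = {ω | ω 0 = x} := by ext; simp
  rw [h0, c.law_start, one_mul] at h
  rw [← h]
  have hm : MeasurableSet {ω : ℕ → I | ω 0 = x} := by measurability
  have hae : ∀ᵐ ω ∂(c.law x), ω 0 = x := (mem_ae_iff_prob_eq_one hm).2 (c.law_start x)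
  refine measure_congr ?_
  filter_upwards [hae] with ω hω
  refine propext ⟨fun h => ⟨fun i hi => ?_, fun i _ hi => h i (by omega)⟩,
    fun h i hi => h.2 i (Nat.zero_le _) (by omega)⟩
  obtain rfl : i = 0 := by omega
  exact hω

theorem ET2_add_ET (x y : I) :
    c.ET2 x y + c.ET x y = 2 * ∑' n : ℕ, (n + 1) * c.survival {y}ᶜ n x := by
  classical
  have := c.measurableSingletonClass
  rw [ET2, ET, ← lintegral_add_right _ (measurable_hitTime y)]
  simp_rw [← tsum_ite_hitTime]
  rw [lintegral_tsum fun n => (Measurable.ite (measurableSet_forall_ne y n) measurable_const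
    measurable_const).aemeasurable, ← ENNReal.tsum_mul_left]
  refine tsum_congr fun n => ?_
  rw [← c.law_forall_ne, ← mul_assoc, ← lintegral_indicator_const (measurableSet_forall_ne y n)]
  simp only [Set.indicator_apply, Set.mem_ofPred_eq]

end Law

/-! ### The chain killed at the parent of `x` -/

theorem survival_branch {x : I} (hx : x ≠ c.root) (n : ℕ) {y : I} (hy : y ∈ c.branch x) :
    c.survival {c.par x}ᶜ n y = c.survival (c.branch x) n y := by
  have hsub : ∀ {w}, w ∈ c.branch x → w ∈ ({c.par x}ᶜ : Set I) := fun hw h =>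
    c.par_notMem_branch hx (Set.mem_singleton_iff.1 h ▸ hw)
  induction n generalizing y with
  | zero => simp only [survival, Function.iterate_zero, id, Set.indicator_of_mem hy,
      Set.indicator_of_mem (hsub hy)]
  | succ n ih =>
    rw [survival_succ, survival_succ, killedOp, killedOp, Set.indicator_of_mem hy,
      Set.indicator_of_mem (hsub hy)]
    refine tsum_congr fun w => ?_
    by_cases hP : c.P y w = 0
    · simp [hP]
    rcases c.mem_branch_or_eq_par hy hP with hw | rfl
    · rw [Set.indicator_of_mem hw, Set.indicator_of_mem (hsub hw), ih hw]
    · simp [c.par_notMem_branch hx]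

open Classical in
theorem killedOp_branch_one {x : I} (hx : x ≠ c.root) :
    c.killedOp (c.branch x) ((c.branch x).indicator 1) + c.mu x • Pi.single x 1
      = (c.branch x).indicator 1 := by
  ext y
  by_cases hy : y ∈ c.branch x
  · simp only [Pi.add_apply, killedOp, Set.indicator_of_mem hy, Pi.smul_apply, smul_eq_mul,
      Pi.one_apply, Set.indicator_indicator, Set.inter_self]
    have h : c.mu x * (Pi.single x 1 : I → ℝ≥0∞) y
        = ∑' w, if w = c.par x then c.P y (c.par x) else 0 := by
      rw [tsum_ite_eq]
      by_cases hyx : y = x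
      · subst hyx; simp [mu]
      · simp [hyx, c.P_par_eq_zero hx hy hyx]
    rw [h, ← ENNReal.tsum_add, ← c.P_row y]
    refine tsum_congr fun w => ?_
    by_cases hP : c.P y w = 0
    · by_cases hw : w = c.par x
      · simp [← hw, hP]
      · simp [hw, hP]
    rcases c.mem_branch_or_eq_par hy hP with hw | rfl
    · have : w ≠ c.par x := fun h => c.par_notMem_branch hx (h ▸ hw)
      simp [hw, this]
    · simp [c.par_notMem_branch hx]
  · have hyx : y ≠ x := fun h => hy (h ▸ c.mem_branch_self x)
    simp [killedOp, hy, hyx]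

open Classical in
theorem survival_branch_succ_add {x : I} (hx : x ≠ c.root) (n : ℕ) :
    c.survival (c.branch x) (n + 1)
      + c.mu x • (c.killedOp (c.branch x))^[n] (Pi.single x 1) = c.survival (c.branch x) n := by
  induction n with
  | zero => exact c.killedOp_branch_one hx
  | succ n ih =>
    rw [survival_succ, Function.iterate_succ_apply', ← killedOp_smul, ← killedOp_add, ih,
      survival_succ]

open Classical in
theorem survival_branch_add_sum {x : I} (hx : x ≠ c.root) (n : ℕ) {z : I}
    (hz : z ∈ c.branch x) :
    c.survival (c.branch x) n z + c.mu x * ∑ k ∈ Finset.range n,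
      (c.killedOp (c.branch x))^[k] (Pi.single x 1) z = 1 := by
  induction n with
  | zero => simp [survival, hz]
  | succ n ih =>
    rw [Finset.sum_range_succ, mul_add, add_comm (c.mu x * _), ← add_assoc]
    refine (congrArg (· + _) ?_).trans ih
    exact congrFun (c.survival_branch_succ_add hx n) z

/-- The mean time needed to climb from `b` to its parent. -/
def climbTime (b : I) : ℝ≥0∞ := c.piSet (c.branch b) / (c.mu b * c.invm b)

open Classical in
/-- The mean time needed to climb from `z` to the parent of `x`, as a sum over the path. -/
def climbSum (x z : I) : ℝ≥0∞ :=
  ∑' b, if b ∈ c.branch x ∧ z ∈ c.branch b then c.climbTime b else 0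

theorem climbTime_ne_top {b : I} (hb : b ≠ c.root) : c.climbTime b ≠ ⊤ :=
  ENNReal.div_ne_top (c.piSet_ne_top _) (c.conductance_ne_zero hb)

theorem invm_mul_mu_mul_climbTime {b : I} (hb : b ≠ c.root) :
    c.invm b * (c.mu b * c.climbTime b) = c.piSet (c.branch b) := by
  rw [← mul_assoc, mul_comm (c.invm b), climbTime,
    ENNReal.mul_div_cancel (c.conductance_ne_zero hb) (c.conductance_ne_top b)]

open Classical in
theorem mu_mul_climbTime {z : I} (hz : z ≠ c.root) :
    c.mu z * c.climbTime z = 1 + ∑' w, if c.par w = z then c.P z w * c.climbTime w else 0 := by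
  rw [← ENNReal.mul_right_inj (c.invm_pos z) (c.invm_ne_top z), c.invm_mul_mu_mul_climbTime hz,
    c.piSet_branch hz, mul_add, mul_one, ← ENNReal.tsum_mul_left]
  congr 1
  refine tsum_congr fun w => ?_
  split_ifs with hw
  · have hwr : w ≠ c.root := by
      rintro rfl
      exact hz (hw.symm.trans c.par_root)
    rw [← c.invm_mul_mu_mul_climbTime hwr, ← mul_assoc, ← mul_assoc, c.invm_rev z w, mu, hw]
  · simp

theorem climbSum_of_notMem {x z : I} (hz : z ∉ c.branch x) : c.climbSum x z = 0 := by
  have h : ∀ b, ¬ (b ∈ c.branch x ∧ z ∈ c.branch b) := fun b h =>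
    hz (c.branch_trans h.1 h.2)
  simp [climbSum, h]

theorem climbSum_eq_par_add {x z : I} (hx : x ≠ c.root) (hz : z ∈ c.branch x) :
    c.climbSum x z = c.climbSum x (c.par z) + c.climbTime z := by
  classical
  have hzr := c.ne_root_of_mem_branch hx hz
  rw [climbSum, climbSum, ← tsum_ite_eq z (fun b => c.climbTime b), ← ENNReal.tsum_add]
  refine tsum_congr fun b => ?_
  by_cases hb : b = z
  · subst hb
    simp [hz, c.mem_branch_self, c.par_notMem_branch hzr]
  · have : z ∈ c.branch b ↔ c.par z ∈ c.branch b := by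
      rw [c.mem_branch_iff_par]
      simp [Ne.symm hb]
    simp [this, hb]

theorem climbSum_self {x : I} (hx : x ≠ c.root) : c.climbSum x x = c.climbTime x := by
  rw [c.climbSum_eq_par_add hx (c.mem_branch_self x),
    c.climbSum_of_notMem (c.par_notMem_branch hx), zero_add]

/-- Induction along the branch stemming from `x`. -/
theorem branch_induction {x : I} {p : I → Prop} (h0 : p x)
    (hs : ∀ y, c.par y ∈ c.branch x → p (c.par y) → p y) {y : I} (hy : y ∈ c.branch x) : p y := by
  obtain ⟨n, h⟩ := hy
  induction n generalizing y with
  | zero => exact (show y = x from h) ▸ h0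
  | succ n ih => exact hs y ⟨n, h⟩ (ih h)

theorem climbSum_ne_top {x z : I} (hx : x ≠ c.root) (hz : z ∈ c.branch x) :
    c.climbSum x z ≠ ⊤ := by
  refine c.branch_induction (p := fun z => c.climbSum x z ≠ ⊤) ?_ (fun y hy ih => ?_) hz
  · exact c.climbSum_self hx ▸ c.climbTime_ne_top hx
  · have hyx := c.mem_branch_iff_par.2 (Or.inr hy)
    rw [c.climbSum_eq_par_add hx hyx]
    exact ENNReal.add_ne_top.2 ⟨ih, c.climbTime_ne_top (c.ne_root_of_mem_branch hx hyx)⟩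

/-- The Poisson equation for the mean climbing time. -/
theorem climbSum_eq_one_add {x z : I} (hx : x ≠ c.root) (hz : z ∈ c.branch x) :
    c.climbSum x z = 1 + c.killedOp (c.branch x) (c.climbSum x) z := by
  classical
  have hzr := c.ne_root_of_mem_branch hx hz
  have hind : (c.branch x).indicator (c.climbSum x) = c.climbSum x :=
    Set.indicator_eq_self.2 fun w hw => by_contra fun h => hw (c.climbSum_of_notMem h)
  set S := ∑' w, if c.par w = z then c.P z w * c.climbTime w else 0 with hS
  have hmu : c.mu z * c.climbTime z = 1 + S := c.mu_mul_climbTime hzr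
  have hSfin : S ≠ ⊤ := by
    refine ne_top_of_le_ne_top
      (ENNReal.mul_ne_top (c.P_ne_top z (c.par z)) (c.climbTime_ne_top hzr)) ?_
    exact le_add_self.trans hmu.ge
  have hpt : ∀ w, c.P z w * c.climbSum x w + (if w = c.par z then c.mu z * c.climbTime z else 0)
      = c.P z w * c.climbSum x z + if c.par w = z then c.P z w * c.climbTime w else 0 := by
    intro w
    by_cases hP : c.P z w = 0
    · have : w ≠ c.par z := by
        rintro rfl
        exact c.mu_pos z hzr hP
      simp [hP, this]
    rcases c.P_support _ _ hP with rfl | rfl | h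
    · simp [c.par_ne_self hzr, (c.par_ne_self hzr).symm]
    · have : c.par (c.par z) ≠ z := by
        intro h
        by_cases hr : c.par z = c.root
        · rw [hr, c.par_root] at h
          exact hzr h.symm
        · have h1 := c.depth_par _ hr
          have h2 := c.depth_par _ hzr
          rw [h] at h1
          omega
      rw [if_pos rfl, if_neg this, c.climbSum_eq_par_add hx hz, mul_add, add_zero, mu]
    · have hw : w ∈ c.branch x := c.mem_branch_iff_par.2 (Or.inr (h ▸ hz))
      have hne : w ≠ c.par z := by
        rintro rfl
        have h1 := c.depth_par _ (c.ne_root_of_mem_branch hx hw)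
        have h2 := c.depth_par _ hzr
        rw [← h] at h1
        omega
      rw [if_neg hne, if_pos h.symm, c.climbSum_eq_par_add hx hw, ← h, mul_add, add_zero]
  have hsum := tsum_congr (L := .unconditional I) hpt
  rw [ENNReal.tsum_add, ENNReal.tsum_add, tsum_ite_eq, ENNReal.tsum_mul_right, c.P_row, one_mul,
    ← hS, hmu, ← add_assoc] at hsum
  rw [killedOp, Set.indicator_of_mem hz, hind, add_comm]
  exact ((ENNReal.add_left_inj hSfin).1 hsum).symm

/-- The mean exit time from `S`. -/
def exitMean (S : Set I) (z : I) : ℝ≥0∞ := ∑' n, c.survival S n z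

theorem exitMean_eq_one_add (S : Set I) {z : I} (hz : z ∈ S) :
    c.exitMean S z = 1 + c.killedOp S (c.exitMean S) z := by
  have hind : ∀ w, S.indicator (c.exitMean S) w = ∑' n, S.indicator (c.survival S n) w := by
    intro w
    by_cases hw : w ∈ S <;> simp [hw, exitMean]
  rw [exitMean, tsum_eq_zero_add' ENNReal.summable]
  congr 1
  · simp [survival, hz]
  · simp only [survival_succ, killedOp, Set.indicator_of_mem hz, hind, ← ENNReal.tsum_mul_left]
    exact ENNReal.tsum_comm

theorem killedOp_mono (S : Set I) {f g : I → ℝ≥0∞} (h : f ≤ g) :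
    c.killedOp S f ≤ c.killedOp S g :=
  fun _ => Set.indicator_le_indicator (ENNReal.tsum_le_tsum fun _ =>
    mul_le_mul_right (Set.indicator_le_indicator (h _)) _)

theorem exitMean_le_climbSum {x : I} (hx : x ≠ c.root) :
    c.exitMean (c.branch x) ≤ c.climbSum x := by
  have hpart : ∀ n : ℕ, ∀ z, ∑ k ∈ Finset.range n, c.survival (c.branch x) k z
      ≤ c.climbSum x z := by
    intro n
    induction n with
    | zero => simp
    | succ n ih =>
      intro z
      by_cases hz : z ∈ c.branch x
      · rw [Finset.sum_range_succ', c.climbSum_eq_one_add hx hz, add_comm]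
        refine add_le_add (by simp [survival, hz]) ?_
        refine le_trans (le_of_eq ?_) (c.killedOp_mono _ ih z)
        have : ∀ m : ℕ, ∑ k ∈ Finset.range m, c.survival (c.branch x) (k + 1) z
            = c.killedOp (c.branch x)
              (fun z => ∑ k ∈ Finset.range m, c.survival (c.branch x) k z) z := by
          intro m
          induction m with
          | zero => simp [killedOp, Set.indicator]
          | succ m ihm =>
            rw [Finset.sum_range_succ, ihm, survival_succ, ← Pi.add_apply, ← killedOp_add]
            simp only [Finset.sum_range_succ]
            rfl
        exact this n
      · simp [c.survival_of_notMem hz]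
  intro z
  rw [exitMean, ENNReal.tsum_eq_iSup_nat]
  exact iSup_le fun n => hpart n z

open Classical in
/-- The killed chain started anywhere in the branch visits `x` for a mean time `1 / μ_x`. -/
theorem mu_mul_tsum_killedOp_iterate {x z : I} (hx : x ≠ c.root) (hz : z ∈ c.branch x) :
    c.mu x * ∑' n, (c.killedOp (c.branch x))^[n] (Pi.single x 1) z = 1 := by
  have hfin : ∑' n, c.survival (c.branch x) n z ≠ ⊤ :=
    ne_top_of_le_ne_top (c.climbSum_ne_top hx hz) (c.exitMean_le_climbSum hx z)
  have h1 := ENNReal.tendsto_atTop_zero_of_tsum_ne_top hfin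
  have h2 := ENNReal.Tendsto.const_mul
    (ENNReal.tendsto_nat_tsum fun n => (c.killedOp (c.branch x))^[n] (Pi.single x 1) z)
    (Or.inr (c.P_ne_top x (c.par x)))
  have h3 := h1.add h2
  rw [zero_add] at h3
  refine tendsto_nhds_unique h3 ?_
  exact (tendsto_congr fun n => c.survival_branch_add_sum hx n hz).2 tendsto_const_nhds

theorem mul_tsum_survival {x : I} (hx : x ≠ c.root) (k : ℕ) :
    c.mu x * c.invm x * ∑' m, c.survival (c.branch x) (m + k) x
      = ∑' z, c.invm z * c.survival (c.branch x) k z := by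
  classical
  have h : ∀ m, c.invm x * c.survival (c.branch x) (m + k) x
      = ∑' z, c.invm z * ((c.killedOp (c.branch x))^[m] (Pi.single x 1) z
          * c.survival (c.branch x) k z) := by
    intro m
    rw [← tsum_mul_killedOp_iterate, tsum_eq_single x fun y hy => by simp [hy], Pi.single_eq_same,
      one_mul, survival, Function.iterate_add_apply, survival]
  rw [mul_assoc, ← ENNReal.tsum_mul_left, tsum_congr h, ENNReal.tsum_comm,
    ← ENNReal.tsum_mul_left]
  refine tsum_congr fun z => ?_
  by_cases hz : z ∈ c.branch x
  · rw [ENNReal.tsum_mul_left, ENNReal.tsum_mul_right, mul_left_comm, ← mul_assoc (c.mu x),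
      c.mu_mul_tsum_killedOp_iterate hx hz, one_mul]
  · simp [c.survival_of_notMem hz]

theorem exitMean_self {x : I} (hx : x ≠ c.root) :
    c.exitMean (c.branch x) x = c.climbTime x := by
  classical
  rw [climbTime, ENNReal.eq_div_iff (c.conductance_ne_zero hx) (c.conductance_ne_top x)]
  refine (c.mul_tsum_survival hx 0).trans ?_
  rw [piSet_eq_tsum]
  refine tsum_congr fun z => ?_
  by_cases hz : z ∈ c.branch x <;> simp [survival, hz]

theorem exitMean_eq_climbSum {x z : I} (hx : x ≠ c.root) (hz : z ∈ c.branch x) :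
    c.exitMean (c.branch x) z = c.climbSum x z := by
  refine c.branch_induction (p := fun z => c.exitMean (c.branch x) z = c.climbSum x z) ?_
    (fun y hy ih => ?_) hz
  · rw [c.exitMean_self hx, c.climbSum_self hx]
  · have hyx := c.mem_branch_iff_par.2 (Or.inr hy)
    have hle := c.exitMean_le_climbSum hx
    have hfin := c.climbSum_ne_top hx hy
    refine le_antisymm (hle y) (not_lt.1 fun hlt => ?_)
    rw [c.exitMean_eq_one_add _ hy, c.climbSum_eq_one_add hx hy,
      ENNReal.add_right_inj one_ne_top, killedOp, killedOp, Set.indicator_of_mem hy,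
      Set.indicator_of_mem hy] at ih
    rw [c.climbSum_eq_one_add hx hy, killedOp, Set.indicator_of_mem hy] at hfin
    refine (ENNReal.tsum_lt_tsum (i := y) (ih ▸ (ENNReal.add_ne_top.1 hfin).2)
      (fun w => mul_le_mul_right (Set.indicator_le_indicator (hle w)) _) ?_).ne ih
    rw [Set.indicator_of_mem hyx, Set.indicator_of_mem hyx]
    exact (ENNReal.mul_lt_mul_iff_right (c.lam_pos y (c.ne_root_of_mem_branch hx hyx))
      (c.P_ne_top _ _)).2 hlt

theorem tsum_invm_mul_climbSum (x : I) :
    ∑' z, c.invm z * c.climbSum x z = ∑' b : c.branch x,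
      (c.piSet (c.branch (b : I))) ^ 2 / (c.mu (b : I) * c.invm (b : I)) := by
  classical
  rw [tsum_subtype (c.branch x)
    fun b => (c.piSet (c.branch b)) ^ 2 / (c.mu b * c.invm b)]
  simp only [climbSum, ← ENNReal.tsum_mul_left]
  rw [ENNReal.tsum_comm]
  refine tsum_congr fun b => ?_
  by_cases hb : b ∈ c.branch x
  · rw [Set.indicator_of_mem hb, sq, mul_div_assoc]
    nth_rewrite 1 [piSet_eq_tsum]
    rw [← ENNReal.tsum_mul_right]
    refine tsum_congr fun z => ?_
    by_cases hz : z ∈ c.branch b <;> simp [hb, hz, climbTime]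
  · simp [hb]

theorem mul_tsum_mul_survival {x : I} (hx : x ≠ c.root) :
    c.mu x * c.invm x * ∑' n : ℕ, (n + 1) * c.survival (c.branch x) n x
      = ∑' z, c.invm z * c.climbSum x z := by
  rw [← ENNReal.tsum_tsum_add fun n => c.survival (c.branch x) n x, ENNReal.tsum_comm,
    ← ENNReal.tsum_mul_left, tsum_congr (c.mul_tsum_survival hx), ENNReal.tsum_comm]
  refine tsum_congr fun z => ?_
  rw [ENNReal.tsum_mul_left]
  congr 1
  by_cases hz : z ∈ c.branch x
  · exact c.exitMean_eq_climbSum hx hz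
  · simp [c.survival_of_notMem hz, c.climbSum_of_notMem hz]

end TreeChain

/-- **Lemma (3.1), second moment child → parent**:
`E[(T^x_{p(x)})²] = (2/(μ_x π(x)))·Σ_{b∈B_x} π(B_b)²/(μ_b π(b)) − E[T^x_{p(x)}]`,
stated in the equivalent additive form. -/
theorem ET2_child_parent {I : Type*} [MeasurableSpace I] [Countable I]
    (c : TreeChain I) (x : I) (hx : x ≠ c.root) :
    c.ET2 x (c.par x) + c.ET x (c.par x)
      = 2 / (c.mu x * c.invm x) *
          ∑' b : c.branch x,
            (c.piSet (c.branch (b : I))) ^ 2 / (c.mu (b : I) * c.invm (b : I)) := by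
  simp only [c.ET2_add_ET, c.survival_branch hx _ (c.mem_branch_self x)]
  rw [← c.tsum_invm_mul_climbSum, ← c.mul_tsum_mul_survival hx, ← mul_assoc,
    ENNReal.div_mul_cancel (c.conductance_ne_zero hx) (c.conductance_ne_top x)]
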